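/- arXiv:2303.05018 — 3 statements merged into one kernel-verified Lean document; each statement's English description precedes it below -/
import Mathlib

section
/- Let K ≥ 2 and T ≥ 1 be integers and let G, ℓmax, S be positive reals. Set δ = (G/ℓmax)^{2/3}·K^{1/3}·T^{−1/3} and assume δ ≤ 1/2. Set λ = √(δ/(K·T·G²)) and η = √(2(1 − δ)·ln K/(K·T·ℓmax²)). Then δ·T·ℓmax + S/(2λ) + λ·K·T·G²/(2δ) + η·K·T·ℓmax²/(2(1 − δ)) + (ln K)/η ≤ ((S + 3)/2)·G^{2/3}·ℓmax^{1/3}·K^{1/3}·T^{2/3} + 2·ℓmax·√(K·T·ln K). -/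
theorem cube_aux (x : ℝ) (hx : 0 < x) : ∃ y : ℝ, 0 < y ∧ x = y ^ 3 ∧ x ^ ((1 : ℝ) / 3) = y ∧
    x ^ ((2 : ℝ) / 3) = y ^ 2 ∧ x ^ (-(1 : ℝ) / 3) = y⁻¹ := by
  refine ⟨x ^ ((1 : ℝ) / 3), Real.rpow_pos_of_pos hx _, ?_, rfl, ?_, ?_⟩
  · rw [← Real.rpow_natCast, ← Real.rpow_mul hx.le]; norm_num
  · rw [← Real.rpow_natCast, ← Real.rpow_mul hx.le]; norm_num
  · rw [← Real.rpow_neg hx.le]; norm_num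

/-- Arithmetic content of Remark 1: with the stated choices of `δ`, `λ`, `η`, the corrected
expected regret bound of OKS is of order `(S + 1)·K^{1/3}·T^{2/3}`. -/
theorem oks_remark_arithmetic (K T : ℕ) (hK : 2 ≤ K) (hT : 1 ≤ T)
    (G lmax S : ℝ) (hG : 0 < G) (hlmax : 0 < lmax) (hS : 0 < S)
    (δ lam η : ℝ)
    (hδ : δ = (G / lmax) ^ ((2 : ℝ) / 3) * (K : ℝ) ^ ((1 : ℝ) / 3) * (T : ℝ) ^ (-(1 : ℝ) / 3))
    (hδhalf : δ ≤ 1 / 2)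
    (hlam : lam = Real.sqrt (δ / (K * T * G ^ 2)))
    (hη : η = Real.sqrt (2 * (1 - δ) * Real.log K / (K * T * lmax ^ 2))) :
    δ * T * lmax + S / (2 * lam) + lam * K * T * G ^ 2 / (2 * δ)
        + η * K * T * lmax ^ 2 / (2 * (1 - δ)) + Real.log K / η
      ≤ ((S + 3) / 2) * G ^ ((2 : ℝ) / 3) * lmax ^ ((1 : ℝ) / 3) * (K : ℝ) ^ ((1 : ℝ) / 3)
          * (T : ℝ) ^ ((2 : ℝ) / 3)
        + 2 * lmax * Real.sqrt (K * T * Real.log K) := by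
  have hK0 : (0 : ℝ) < K := by positivity
  have hT0 : (0 : ℝ) < T := by positivity
  have hL : 0 < Real.log K := Real.log_pos (by exact_mod_cast hK)
  rw [Real.div_rpow hG.le hlmax.le] at hδ
  generalize Real.log (K : ℝ) = L at *
  generalize (K : ℝ) = k at *
  generalize (T : ℝ) = t at *
  have hδ1 : 0 < 1 - δ := by linarith
  have hη0 : 0 < η := by rw [hη]; positivity
  have hη2 : η ^ 2 = 2 * (1 - δ) * L / (k * t * lmax ^ 2) := by
    rw [hη]; exact Real.sq_sqrt (by positivity)
  have h4 : η * k * t * lmax ^ 2 / (2 * (1 - δ)) = L / η := by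
    rw [div_eq_div_iff (by positivity) hη0.ne']
    have : η ^ 2 * (k * t * lmax ^ 2) = 2 * (1 - δ) * L := by
      rw [hη2]; field_simp
    linarith
  have h5 : L / η ≤ lmax * Real.sqrt (k * t * L) := by
    rw [div_le_iff₀ hη0]
    refine (sq_le_sq₀ hL.le (by positivity)).1 ?_
    rw [mul_pow, mul_pow, Real.sq_sqrt (by positivity), hη2]
    have : lmax ^ 2 * (k * t * L) * (2 * (1 - δ) * L / (k * t * lmax ^ 2))
      = 2 * (1 - δ) * L ^ 2 := by field_simp
    rw [this]
    nlinarith [sq_nonneg L]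
  obtain ⟨g, hg, rfl, hg1, hg2, -⟩ := cube_aux G hG
  obtain ⟨m, hm, rfl, hm1, hm2, -⟩ := cube_aux lmax hlmax
  obtain ⟨a, ha, rfl, ha1, -, -⟩ := cube_aux k hK0
  obtain ⟨b, hb, rfl, -, hb2, hb3⟩ := cube_aux t hT0
  rw [hg2, hm2, ha1, hb3] at hδ
  rw [hg2, hm1, ha1, hb2]
  have hlam' : lam = 1 / (g ^ 2 * m * a * b ^ 2) := by
    rw [hlam, Real.sqrt_eq_iff_mul_self_eq (by rw [hδ]; positivity) (by positivity), hδ]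
    field_simp
  have e1 : δ * b ^ 3 * m ^ 3 = g ^ 2 * m * a * b ^ 2 := by rw [hδ]; field_simp
  have e2 : S / (2 * lam) = S / 2 * (g ^ 2 * m * a * b ^ 2) := by rw [hlam']; field_simp
  have e3 : lam * a ^ 3 * b ^ 3 * (g ^ 3) ^ 2 / (2 * δ) = 1 / 2 * (g ^ 2 * m * a * b ^ 2) := by
    rw [hlam', hδ]; field_simp
  rw [e1, e2, e3, h4]
  linarith
end

section
/- Let K ≥ 1, let q : Fin K → ℝ be a probability vector with q_i > 0 for all i, let η_i > 0 and c_i ≥ 0 for each i. For μ < μ̄ := min_i (c_i + q_i^{−7/8}/η_i), every base q_i^{−7/8} + η_i·(c_i − μ) is positive, and the map μ ↦ ∑_{i=1}^K (q_i^{−7/8} + η_i·(c_i − μ))^{−8/7} is continuous and strictly increasing on (−∞, μ̄), tends to 0 as μ → −∞ and to +∞ as μ → μ̄⁻. Consequently there exists a unique μ* < μ̄ with ∑_{i=1}^K (q_i^{−7/8} + η_i·(c_i − μ*))^{−8/7} = 1, so the update q⁺_i = (q_i^{−7/8} + η_i·(c_i − μ*))^{−8/7} produces a probability vector. -/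
open Finset Filter

/-- Solvability of the normalization equation in the IOKS mirror-descent update with the
modified 8-Tsallis entropy: for `μ` below `μ̄ = minᵢ (cᵢ + qᵢ^{−7/8}/ηᵢ)` every base
`qᵢ^{−7/8} + ηᵢ(cᵢ − μ)` is positive, the map
`μ ↦ ∑ᵢ (qᵢ^{−7/8} + ηᵢ(cᵢ − μ))^{−8/7}` is continuous and strictly increasing on
`(−∞, μ̄)`, tends to `0` at `−∞` and to `+∞` as `μ → μ̄⁻`, and hence there is a unique
`μ* < μ̄` making the updated coordinates sum to `1`. -/
theorem ioks_normalizer_exists_unique (K : ℕ) (hK : 1 ≤ K)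
    (q η c : Fin K → ℝ) (hq : ∀ i, 0 < q i) (hqsum : ∑ i, q i = 1)
    (hη : ∀ i, 0 < η i) (hc : ∀ i, 0 ≤ c i)
    (μbar : ℝ)
    (hμbar : IsGLB (Set.range fun i => c i + (q i ^ (-(7 : ℝ) / 8)) / η i) μbar)
    (φ : ℝ → ℝ)
    (hφ : ∀ μ, φ μ = ∑ i, (q i ^ (-(7 : ℝ) / 8) + η i * (c i - μ)) ^ (-(8 : ℝ) / 7)) :
    (∀ μ < μbar, ∀ i, 0 < q i ^ (-(7 : ℝ) / 8) + η i * (c i - μ)) ∧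
    ContinuousOn φ (Set.Iio μbar) ∧
    StrictMonoOn φ (Set.Iio μbar) ∧
    Tendsto φ atBot (nhds 0) ∧
    Tendsto φ (nhdsWithin μbar (Set.Iio μbar)) atTop ∧
    (∃! μstar : ℝ, μstar < μbar ∧
      ∑ i, (q i ^ (-(7 : ℝ) / 8) + η i * (c i - μstar)) ^ (-(8 : ℝ) / 7) = 1) := by
  have hφ' : φ = fun μ => ∑ i, (q i ^ (-(7 : ℝ) / 8) + η i * (c i - μ)) ^ (-(8 : ℝ) / 7) :=
    funext hφ
  have hpos : ∀ μ < μbar, ∀ i, 0 < q i ^ (-(7 : ℝ) / 8) + η i * (c i - μ) := by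
    intro μ hμ i
    have h1 : μbar ≤ c i + (q i ^ (-(7 : ℝ) / 8)) / η i := hμbar.1 ⟨i, rfl⟩
    have h2 : 0 < η i * (c i + (q i ^ (-(7 : ℝ) / 8)) / η i - μ) :=
      mul_pos (hη i) (by linarith)
    have h3 : η i * ((q i ^ (-(7 : ℝ) / 8)) / η i) = q i ^ (-(7 : ℝ) / 8) :=
      mul_div_cancel₀ _ (hη i).ne'
    nlinarith
  have : Nonempty (Fin K) := ⟨⟨0, hK⟩⟩
  have hcont : ContinuousOn φ (Set.Iio μbar) := by
    rw [hφ']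
    refine continuousOn_finsetSum _ fun i _ => ?_
    refine ContinuousOn.rpow_const (by fun_prop) ?_
    intro μ hμ
    exact Or.inl (hpos μ hμ i).ne'
  have hmono : StrictMonoOn φ (Set.Iio μbar) := by
    intro a ha b hb hab
    rw [hφ, hφ]
    refine Finset.sum_lt_sum_of_nonempty Finset.univ_nonempty fun i _ => ?_
    refine Real.rpow_lt_rpow_of_neg (hpos b hb i) ?_ (by norm_num)
    have := mul_lt_mul_of_pos_left hab (hη i)
    nlinarith
  have hbot : Tendsto φ atBot (nhds 0) := by
    rw [hφ']
    have : (0 : ℝ) = ∑ i : Fin K, (0 : ℝ) := by simp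
    rw [this]
    refine tendsto_finsetSum _ fun i _ => ?_
    have h1 : Tendsto (fun μ : ℝ => q i ^ (-(7 : ℝ) / 8) + η i * (c i - μ)) atBot atTop := by
      refine tendsto_atTop_add_const_left _ _ ?_
      refine Tendsto.const_mul_atTop (hη i) ?_
      change Tendsto (fun μ : ℝ => c i - μ) atBot atTop
      simp only [sub_eq_add_neg]
      exact tendsto_atTop_add_const_left _ _ tendsto_neg_atBot_atTop
    have h2 := (tendsto_rpow_neg_atTop (y := 8 / 7) (by norm_num)).comp h1
    rw [← neg_div] at h2
    exact h2
  have htop : Tendsto φ (nhdsWithin μbar (Set.Iio μbar)) atTop := by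
    obtain ⟨j, hj⟩ := Finite.exists_min fun i => c i + (q i ^ (-(7 : ℝ) / 8)) / η i
    have hjb : μbar = c j + (q j ^ (-(7 : ℝ) / 8)) / η j := by
      refine hμbar.unique (IsLeast.isGLB ⟨⟨j, rfl⟩, ?_⟩)
      rintro _ ⟨i, rfl⟩
      exact hj i
    have h0 : q j ^ (-(7 : ℝ) / 8) + η j * (c j - μbar) = 0 := by
      have := (hη j).ne'
      rw [hjb]; field_simp; ring
    have h1 : Tendsto (fun μ : ℝ => q j ^ (-(7 : ℝ) / 8) + η j * (c j - μ))
        (nhdsWithin μbar (Set.Iio μbar)) (nhdsWithin 0 (Set.Ioi 0)) := by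
      refine tendsto_nhdsWithin_iff.2 ⟨?_, ?_⟩
      · refine Tendsto.mono_left ?_ nhdsWithin_le_nhds
        have : Continuous (fun μ : ℝ => q j ^ (-(7 : ℝ) / 8) + η j * (c j - μ)) := by fun_prop
        have h := this.tendsto μbar
        rwa [h0] at h
      · filter_upwards [self_mem_nhdsWithin] with μ hμ
        exact hpos μ hμ j
    have h2 : Tendsto (fun μ : ℝ => (q j ^ (-(7 : ℝ) / 8) + η j * (c j - μ)) ^ (-(8 : ℝ) / 7))
        (nhdsWithin μbar (Set.Iio μbar)) atTop :=
      (tendsto_rpow_neg_nhdsGT_zero (by norm_num)).comp h1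
    refine tendsto_atTop_mono' _ ?_ h2
    filter_upwards [self_mem_nhdsWithin] with μ hμ
    rw [hφ]
    exact Finset.single_le_sum
      (f := fun i => (q i ^ (-(7 : ℝ) / 8) + η i * (c i - μ)) ^ (-(8 : ℝ) / 7))
      (fun i _ => (Real.rpow_pos_of_pos (hpos μ hμ i) _).le) (Finset.mem_univ j)
  refine ⟨hpos, hcont, hmono, hbot, htop, ?_⟩
  obtain ⟨a, ha1, ha⟩ := ((hbot.eventually_le_const one_pos).and
    (eventually_lt_atBot μbar)).exists
  obtain ⟨b, hb1, hb⟩ := ((htop.eventually_ge_atTop 1).and self_mem_nhdsWithin).exists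
  obtain ⟨m, hm, hm1⟩ := isPreconnected_Iio.intermediate_value
    (Set.mem_Iio.2 ha) hb hcont ⟨ha1, hb1⟩
  refine ⟨m, ⟨hm, by rw [← hφ, hm1]⟩, ?_⟩
  rintro y ⟨hy, hy1⟩
  rw [← hφ] at hy1
  exact hmono.injOn hy hm (hy1.trans hm1.symm)
end

section
/- Let C₀ ≥ 0 and let g : ℝ → ℝ be differentiable with g(x) ≥ 0 and (g'(x))² ≤ C₀·g(x) for all x ∈ ℝ. Then the function √g is (√C₀/2)-Lipschitz: for all a, b ∈ ℝ, |√(g(b)) − √(g(a))| ≤ (√C₀/2)·|b − a|. -/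
/-- For smooth losses with `ν = 2`: if `g ≥ 0` is differentiable with `(g')² ≤ C₀·g`
everywhere, then `√g` is `(√C₀/2)`-Lipschitz. -/
theorem sqrt_lipschitz_smooth_nu_two (C₀ : ℝ) (hC₀ : 0 ≤ C₀) (g : ℝ → ℝ)
    (hg : Differentiable ℝ g) (hg0 : ∀ x, 0 ≤ g x)
    (hg' : ∀ x, (deriv g x) ^ 2 ≤ C₀ * g x) (a b : ℝ) :
    |Real.sqrt (g b) - Real.sqrt (g a)| ≤ (Real.sqrt C₀ / 2) * |b - a| := by
  have key : ∀ e : ℝ, 0 < e →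
      |Real.sqrt (g b + e) - Real.sqrt (g a + e)| ≤ (Real.sqrt C₀ / 2) * |b - a| := by
    intro e he
    have hd : ∀ x ∈ (Set.univ : Set ℝ), HasDerivWithinAt (fun x => Real.sqrt (g x + e))
        (deriv g x / (2 * Real.sqrt (g x + e))) Set.univ x := by
      intro x _
      have hp : g x + e ≠ 0 := by have := hg0 x; positivity
      exact (((hg x).hasDerivAt.add_const e).sqrt hp).hasDerivWithinAt
    have hb : ∀ x ∈ (Set.univ : Set ℝ),
        ‖deriv g x / (2 * Real.sqrt (g x + e))‖ ≤ Real.sqrt C₀ / 2 := by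
      intro x _
      have h0 := hg0 x
      have hp : 0 < Real.sqrt (g x + e) := Real.sqrt_pos.2 (by positivity)
      have h1 : |deriv g x| ≤ Real.sqrt C₀ * Real.sqrt (g x + e) := by
        rw [← Real.sqrt_mul hC₀]
        apply Real.abs_le_sqrt
        nlinarith [hg' x, mul_nonneg hC₀ he.le]
      rw [Real.norm_eq_abs, abs_div, abs_of_pos (by positivity : 0 < 2 * Real.sqrt (g x + e)),
        div_le_iff₀ (by positivity)]
      linarith
    have := convex_univ.norm_image_sub_le_of_norm_hasDerivWithin_le hd hb
      (Set.mem_univ a) (Set.mem_univ b)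
    simpa only [Real.norm_eq_abs] using this
  have hc : Continuous fun e : ℝ => |Real.sqrt (g b + e) - Real.sqrt (g a + e)| := by
    fun_prop
  have ht := (hc.tendsto 0).mono_left (nhdsWithin_le_nhds (s := Set.Ioi (0 : ℝ)))
  simp only [add_zero] at ht
  exact le_of_tendsto ht (Filter.eventually_of_mem self_mem_nhdsWithin key)
end
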